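/- Let σ > 0, r ∈ [0,1], and λ ∈ ℕ with λ ≥ 1. For κ ∈ ℕ define the Gaussian mixture P̄(κ) = Σ_{k=0}^{κ} Binom(k; κ, r)·N(2k, σ) on ℝ, so that P̄(1) = (1−r)·N(0,σ) + r·N(2,σ). Then for every α ≥ 1: H_α(P̄(λ) ‖ N(0,σ)) ≥ H_α(P̄(1) ‖ N(0,σ)), and for every 0 ≤ α < 1: H_α(N(0,σ) ‖ P̄(λ)) ≥ H_α(N(0,σ) ‖ P̄(1)). -/

import Mathlib

open MeasureTheory ProbabilityTheory ENNReal

noncomputable section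

/-- Hockey-stick divergence `H_α(P‖Q) = sup_A (P(A) − α·Q(A))`. -/
def hsDiv {Ω : Type*} [MeasurableSpace Ω] (α : ℝ) (P Q : Measure Ω) : ℝ :=
  ⨆ A : {s : Set Ω // MeasurableSet s}, ((P A.1).toReal - α * (Q A.1).toReal)

/-- Gaussian on ℝ with mean μ and standard deviation σ. -/
def gauss1 (μ σ : ℝ) : Measure ℝ := gaussianReal μ ⟨σ ^ 2, sq_nonneg σ⟩

/-- Binomial probability `Binom(k; n, q)`. -/
def binomR (n : ℕ) (q : ℝ) (k : ℕ) : ℝ := (n.choose k : ℝ) * q ^ k * (1 - q) ^ (n - k)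

/-- `P̄(κ) = Σ_{k=0}^{κ} Binom(k; κ, r)·N(2k, σ)`. -/
def mixBar (κ : ℕ) (r σ : ℝ) : Measure ℝ :=
  ∑ k : Fin (κ + 1), ENNReal.ofReal (binomR κ r (k : ℕ)) • gauss1 (2 * (k : ℕ)) σ

lemma gauss1_eq (μ σ : ℝ) : gauss1 μ σ = gaussianReal μ (σ ^ 2).toNNReal :=
  congrArg (gaussianReal μ) (Real.toNNReal_of_nonneg (sq_nonneg σ)).symm

instance (μ σ : ℝ) : IsProbabilityMeasure (gauss1 μ σ) := by
  rw [gauss1_eq]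
  infer_instance

lemma binomR_nonneg {n : ℕ} {q : ℝ} (hq0 : 0 ≤ q) (hq1 : q ≤ 1) (k : ℕ) : 0 ≤ binomR n q k := by
  have : 0 ≤ 1 - q := sub_nonneg.2 hq1
  unfold binomR
  positivity

lemma sum_binomR (n : ℕ) (q : ℝ) : ∑ k ∈ Finset.range (n + 1), binomR n q k = 1 := by
  have h := add_pow q (1 - q) n
  rw [add_sub_cancel, one_pow] at h
  rw [h]
  exact Finset.sum_congr rfl fun k _ ↦ by unfold binomR; ring

/-- A monotone function has at least as large a mean under `Binom(n, q)` as under `Binom(1, q)`. -/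
lemma sum_binomR_one_le {n : ℕ} (hn : 1 ≤ n) {q : ℝ} (hq0 : 0 ≤ q) (hq1 : q ≤ 1) {u : ℕ → ℝ}
    (hu : Monotone u) :
    ∑ k ∈ Finset.range 2, binomR 1 q k * u k ≤ ∑ k ∈ Finset.range (n + 1), binomR n q k * u k := by
  have h1 : ∑ k ∈ Finset.range 2, binomR 1 q k * u k = (1 - q) * u 0 + q * u 1 := by
    simp [Finset.sum_range_succ, binomR]
  have hsum := sum_binomR n q
  rw [Finset.sum_range_succ'] at hsum
  have h0 : binomR n q 0 ≤ 1 - q := by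
    simpa [binomR] using pow_le_of_le_one (sub_nonneg.2 hq1) (by linarith) (by omega : n ≠ 0)
  have htail : (∑ k ∈ Finset.range n, binomR n q (k + 1)) * u 1 ≤
      ∑ k ∈ Finset.range n, binomR n q (k + 1) * u (k + 1) := by
    rw [Finset.sum_mul]
    exact Finset.sum_le_sum fun k _ ↦
      mul_le_mul_of_nonneg_left (hu (by omega)) (binomR_nonneg hq0 hq1 _)
  rw [h1, Finset.sum_range_succ']
  have h01 : u 0 ≤ u 1 := hu zero_le_one
  rw [eq_sub_of_add_eq hsum] at htail
  nlinarith [mul_nonneg (sub_nonneg.2 h0) (sub_nonneg.2 h01)]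

lemma toReal_mixBar_apply {κ : ℕ} {r : ℝ} (hr0 : 0 ≤ r) (hr1 : r ≤ 1) (σ : ℝ) (A : Set ℝ) :
    (mixBar κ r σ A).toReal =
      ∑ k ∈ Finset.range (κ + 1), binomR κ r k * (gauss1 (2 * k) σ A).toReal := by
  rw [mixBar, Measure.finsetSum_apply, ENNReal.toReal_sum fun k _ ↦ by
      simpa using ENNReal.mul_ne_top ENNReal.ofReal_ne_top (measure_ne_top _ A),
    ← Fin.sum_univ_eq_sum_range fun k : ℕ ↦ binomR κ r k * (gauss1 (2 * k) σ A).toReal]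
  exact Finset.sum_congr rfl fun k _ ↦ by
    simp [ENNReal.toReal_ofReal (binomR_nonneg hr0 hr1 _)]

lemma toReal_gauss1_le_one (μ σ : ℝ) (A : Set ℝ) : (gauss1 μ σ A).toReal ≤ 1 :=
  measureReal_le_one

lemma toReal_mixBar_le_one {κ : ℕ} {r : ℝ} (hr0 : 0 ≤ r) (hr1 : r ≤ 1) (σ : ℝ) (A : Set ℝ) :
    (mixBar κ r σ A).toReal ≤ 1 := by
  rw [toReal_mixBar_apply hr0 hr1, ← sum_binomR κ r]
  exact Finset.sum_le_sum fun k _ ↦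
    mul_le_of_le_one_right (binomR_nonneg hr0 hr1 _) (toReal_gauss1_le_one _ _ _)

lemma le_hsDiv {Ω : Type*} [MeasurableSpace Ω] {α : ℝ} (hα : 0 ≤ α) {P : Measure Ω} (Q : Measure Ω)
    (hP : ∀ A, (P A).toReal ≤ 1) {A : Set Ω} (hA : MeasurableSet A) :
    (P A).toReal - α * (Q A).toReal ≤ hsDiv α P Q := by
  refine le_ciSup (f := fun A : {s : Set Ω // MeasurableSet s} ↦
    (P A.1).toReal - α * (Q A.1).toReal) ⟨1, ?_⟩ ⟨A, hA⟩
  rintro _ ⟨B, rfl⟩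
  exact (sub_le_self _ (mul_nonneg hα ENNReal.toReal_nonneg)).trans (hP B.1)

lemma hsDiv_le {Ω : Type*} [MeasurableSpace Ω] {α c : ℝ} {P Q : Measure Ω}
    (h : ∀ A, MeasurableSet A → (P A).toReal - α * (Q A).toReal ≤ c) : hsDiv α P Q ≤ c :=
  haveI : Nonempty {s : Set Ω // MeasurableSet s} := ⟨⟨∅, .empty⟩⟩
  ciSup_le fun A ↦ h A.1 A.2

lemma gauss1_apply_eq_preimage (μ σ : ℝ) {A : Set ℝ} (hA : MeasurableSet A) :
    gauss1 μ σ A = gauss1 0 σ ((μ + ·) ⁻¹' A) := by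
  rw [gauss1_eq, gauss1_eq, ← Measure.map_apply (by fun_prop) hA, gaussianReal_map_const_add, zero_add]

lemma monotone_toReal_gauss1 (σ : ℝ) {H : Set ℝ} (hH : MeasurableSet H) (hup : IsUpperSet H) :
    Monotone fun μ ↦ (gauss1 μ σ H).toReal := by
  intro a b hab
  simp only [gauss1_apply_eq_preimage _ σ hH]
  exact measureReal_mono fun x hx ↦ hup (by simpa using hab) hx

lemma antitone_toReal_gauss1 (σ : ℝ) {H : Set ℝ} (hH : MeasurableSet H) (hlow : IsLowerSet H) :
    Antitone fun μ ↦ (gauss1 μ σ H).toReal := by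
  intro a b hab
  simp only [gauss1_apply_eq_preimage _ σ hH]
  exact measureReal_mono fun x hx ↦ hlow (by simpa using hab) hx

lemma gaussianPDFReal_combo_nonneg_iff {v : NNReal} (hv : v ≠ 0) (a b x : ℝ) :
    0 ≤ a * gaussianPDFReal 0 v x + b * gaussianPDFReal 2 v x ↔
      0 ≤ a + b * Real.exp ((2 * x - 2) / v) := by
  have hv' : (v : ℝ) ≠ 0 := by exact_mod_cast hv
  have h : gaussianPDFReal 2 v x = gaussianPDFReal 0 v x * Real.exp ((2 * x - 2) / v) := by
    simp only [gaussianPDFReal]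
    rw [mul_assoc (_⁻¹), ← Real.exp_add]
    congr 2
    field_simp
    ring
  rw [h, show a * gaussianPDFReal 0 v x + b * (gaussianPDFReal 0 v x * Real.exp ((2 * x - 2) / v)) =
    gaussianPDFReal 0 v x * (a + b * Real.exp ((2 * x - 2) / v)) by ring]
  exact mul_nonneg_iff_of_pos_left (gaussianPDFReal_pos 0 v x hv)

/-- Neyman–Pearson: a linear combination of `N(0,σ)` and `N(2,σ)` is maximized over all measurable
sets by an upper set if the weight of `N(2,σ)` is nonnegative, and by a lower set if it is
nonpositive. -/
lemma exists_gauss1_combo_maximizer {σ : ℝ} (hσ : 0 < σ) (a b : ℝ) :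
    ∃ H : Set ℝ, MeasurableSet H ∧ (0 ≤ b → IsUpperSet H) ∧ (b ≤ 0 → IsLowerSet H) ∧
      ∀ A, MeasurableSet A →
        a * (gauss1 0 σ A).toReal + b * (gauss1 2 σ A).toReal ≤
          a * (gauss1 0 σ H).toReal + b * (gauss1 2 σ H).toReal := by
  simp only [gauss1_eq]
  have hv : (σ ^ 2).toNNReal ≠ 0 := (Real.toNNReal_pos.2 (pow_pos hσ 2)).ne'
  set v := (σ ^ 2).toNNReal
  let f : ℝ → ℝ := fun x ↦ a * gaussianPDFReal 0 v x + b * gaussianPDFReal 2 v x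
  have hfm : Measurable f := ((measurable_gaussianPDFReal 0 v).const_mul a).add
    ((measurable_gaussianPDFReal 2 v).const_mul b)
  have hi0 : Integrable fun x ↦ a * gaussianPDFReal 0 v x :=
    (integrable_gaussianPDFReal 0 v).const_mul a
  have hi2 : Integrable fun x ↦ b * gaussianPDFReal 2 v x :=
    (integrable_gaussianPDFReal 2 v).const_mul b
  have hint (A : Set ℝ) :
      a * (gaussianReal 0 v A).toReal + b * (gaussianReal 2 v A).toReal = ∫ x in A, f x := by
    have hpos (m : ℝ) : 0 ≤ ∫ x in A, gaussianPDFReal m v x :=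
      integral_nonneg (gaussianPDFReal_nonneg m v)
    rw [integral_add hi0.restrict hi2.restrict, integral_const_mul, integral_const_mul,
      gaussianReal_apply_eq_integral _ hv, gaussianReal_apply_eq_integral _ hv,
      ENNReal.toReal_ofReal (hpos 0), ENNReal.toReal_ofReal (hpos 2)]
  have hexp {x y : ℝ} (hxy : x ≤ y) :
      Real.exp ((2 * x - 2) / v) ≤ Real.exp ((2 * y - 2) / v) := by gcongr
  refine ⟨{x | 0 ≤ f x}, measurableSet_le measurable_const hfm, fun hb x y hxy hx ↦ ?_,
    fun hb x y hxy hx ↦ ?_, fun A hA ↦ ?_⟩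
  · refine (gaussianPDFReal_combo_nonneg_iff hv a b y).2 ?_
    have := (gaussianPDFReal_combo_nonneg_iff hv a b x).1 hx
    linarith [mul_le_mul_of_nonneg_left (hexp hxy) hb]
  · refine (gaussianPDFReal_combo_nonneg_iff hv a b y).2 ?_
    have := (gaussianPDFReal_combo_nonneg_iff hv a b x).1 hx
    linarith [mul_le_mul_of_nonpos_left (hexp hxy) hb]
  · rw [hint, hint]
    exact setIntegral_le_nonneg hA hfm.stronglyMeasurable (hi0.add hi2)

lemma toReal_mixBar_one_apply {r : ℝ} (hr0 : 0 ≤ r) (hr1 : r ≤ 1) (σ : ℝ) (A : Set ℝ) :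
    (mixBar 1 r σ A).toReal =
      (1 - r) * (gauss1 0 σ A).toReal + r * (gauss1 2 σ A).toReal := by
  rw [toReal_mixBar_apply hr0 hr1]
  simp [Finset.sum_range_succ, binomR]

lemma monotone_two_mul_natCast : Monotone fun k : ℕ ↦ (2 * k : ℝ) := fun i j hij ↦ by
  have : (i : ℝ) ≤ j := Nat.cast_le.2 hij
  dsimp only
  linarith

lemma mixBar_one_le_of_isUpperSet {r : ℝ} (hr0 : 0 ≤ r) (hr1 : r ≤ 1) (σ : ℝ) {n : ℕ} (hn : 1 ≤ n)
    {H : Set ℝ} (hH : MeasurableSet H) (hup : IsUpperSet H) :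
    (mixBar 1 r σ H).toReal ≤ (mixBar n r σ H).toReal := by
  rw [toReal_mixBar_apply hr0 hr1, toReal_mixBar_apply hr0 hr1]
  exact sum_binomR_one_le hn hr0 hr1
    ((monotone_toReal_gauss1 σ hH hup).comp monotone_two_mul_natCast)

lemma mixBar_le_one_of_isLowerSet {r : ℝ} (hr0 : 0 ≤ r) (hr1 : r ≤ 1) (σ : ℝ) {n : ℕ} (hn : 1 ≤ n)
    {H : Set ℝ} (hH : MeasurableSet H) (hlow : IsLowerSet H) :
    (mixBar n r σ H).toReal ≤ (mixBar 1 r σ H).toReal := by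
  rw [toReal_mixBar_apply hr0 hr1, toReal_mixBar_apply hr0 hr1]
  have := sum_binomR_one_le hn hr0 hr1
    ((antitone_toReal_gauss1 σ hH hlow).comp_monotone monotone_two_mul_natCast).neg
  simpa using this

/-- for λ ≥ 1, the binomial Gaussian mixture `P̄(λ)` is at least
as distinguishable from `N(0,σ)` as `P̄(1) = (1−r)·N(0,σ) + r·N(2,σ)`:
`H_α(P̄(λ)‖N(0,σ)) ≥ H_α(P̄(1)‖N(0,σ))` for `α ≥ 1`, and
`H_α(N(0,σ)‖P̄(λ)) ≥ H_α(N(0,σ)‖P̄(1))` for `0 ≤ α < 1`. -/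
theorem stmt_5 (σ : ℝ) (hσ : 0 < σ) (r : ℝ) (hr0 : 0 ≤ r) (hr1 : r ≤ 1)
    (lam : ℕ) (hlam : 1 ≤ lam) (α : ℝ) (hα : 0 ≤ α) :
    (1 ≤ α → hsDiv α (mixBar 1 r σ) (gauss1 0 σ) ≤ hsDiv α (mixBar lam r σ) (gauss1 0 σ)) ∧
    (α < 1 → hsDiv α (gauss1 0 σ) (mixBar 1 r σ) ≤ hsDiv α (gauss1 0 σ) (mixBar lam r σ)) := by
  constructor
  · refine fun _ ↦ hsDiv_le fun A hA ↦ ?_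
    obtain ⟨H, hH, hup, -, hmax⟩ := exists_gauss1_combo_maximizer hσ (1 - r - α) r
    refine le_trans ?_ (le_hsDiv hα _ (toReal_mixBar_le_one hr0 hr1 σ) hH)
    have h1 := mixBar_one_le_of_isUpperSet hr0 hr1 σ hlam hH (hup hr0)
    have h2 := hmax A hA
    rw [toReal_mixBar_one_apply hr0 hr1] at h1 ⊢
    linarith
  · refine fun _ ↦ hsDiv_le fun A hA ↦ ?_
    obtain ⟨H, hH, -, hlow, hmax⟩ := exists_gauss1_combo_maximizer hσ (1 - α * (1 - r)) (-(α * r))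
    refine le_trans ?_ (le_hsDiv hα _ (toReal_gauss1_le_one 0 σ) hH)
    have h1 := mul_le_mul_of_nonneg_left (mixBar_le_one_of_isLowerSet hr0 hr1 σ hlam hH
      (hlow (neg_nonpos.2 (mul_nonneg hα hr0)))) hα
    have h2 := hmax A hA
    rw [toReal_mixBar_one_apply hr0 hr1] at h1 ⊢
    linarith

end
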